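/- Let K satisfy the kernel assumptions, let f^in be a nonnegative function in X_{0,1}, and for each ε ∈ (0,1) let f^ε = (f_i^ε)_{i≥1} be a solution of the discrete RBK system with coefficients a^ε_{i,j} := ε·K(εi, εj) and initial data f_i^{0,ε} := ε^{-1} ∫_{Λ_i^ε} f^in(x) dx; set f_ε(x,t) := Σ_{i≥1} f_i^ε(t)·1_{Λ_i^ε}(x). Then for every T ∈ (0,∞) the family {f_ε(·,t) : ε ∈ (0,1), t ∈ [0,T]} is uniformly integrable on (0,∞): for every δ > 0 there exists η > 0 such that for every measurable set E ⊂ (0,∞) with Lebesgue measure |E| < η one has ∫_E f_ε(x,t) dx < δ for all ε ∈ (0,1) and all t ∈ [0,T]. -/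

import Mathlib

open MeasureTheory

/-- The cell `Λ_i^ε = [(i-1/2)ε, (i+1/2)ε)`. -/
noncomputable def cell (ε : ℝ) (i : ℕ) : Set ℝ :=
  Set.Ico (((i : ℝ) - 1/2) * ε) (((i : ℝ) + 1/2) * ε)

/-- The step function `f_ε(x) = Σ_{i≥1} g_i 1_{Λ_i^ε}(x)`. -/
noncomputable def stepFn (ε : ℝ) (g : ℕ → ℝ) (x : ℝ) : ℝ :=
  ∑' i : ℕ, g (i + 1) * (cell ε (i + 1)).indicator (fun _ => (1:ℝ)) x

/-- `g` is a solution of the discrete RBK coagulation system with coagulation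
coefficients `a` and initial data `g0`: the functions `g i` (for `i ≥ 1`) are nonnegative,
start from `g0 i`, solve the DRBK equations (gain minus loss, both series converging),
have mass bounded by the (finite) initial mass, number of particles bounded by the initial
number, and nonincreasing tail moments. -/
def IsDRBKSol (a : ℕ → ℕ → ℝ) (g0 : ℕ → ℝ) (g : ℕ → ℝ → ℝ) : Prop :=
  (∀ i : ℕ, 1 ≤ i → ∀ t : ℝ, 0 ≤ t → 0 ≤ g i t) ∧
  (∀ i : ℕ, 1 ≤ i → g i 0 = g0 i) ∧
  (∀ i : ℕ, 1 ≤ i → ∀ t : ℝ, 0 ≤ t →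
    Summable (fun j : ℕ => a (i + (j + 1)) (j + 1) * g (i + (j + 1)) t * g (j + 1) t) ∧
    Summable (fun j : ℕ => a i (j + 1) * g i t * g (j + 1) t) ∧
    HasDerivWithinAt (g i)
      ((∑' j : ℕ, a (i + (j + 1)) (j + 1) * g (i + (j + 1)) t * g (j + 1) t) -
        ∑' j : ℕ, a i (j + 1) * g i t * g (j + 1) t) (Set.Ici 0) t) ∧
  Summable (fun i : ℕ => ((i : ℝ) + 1) * g0 (i + 1)) ∧
  (∀ t : ℝ, 0 ≤ t → Summable (fun i : ℕ => ((i : ℝ) + 1) * g (i + 1) t)) ∧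
  (∀ t : ℝ, 0 ≤ t →
    ∑' i : ℕ, ((i : ℝ) + 1) * g (i + 1) t ≤ ∑' i : ℕ, ((i : ℝ) + 1) * g0 (i + 1)) ∧
  (∀ t : ℝ, 0 ≤ t → ∑' i : ℕ, g (i + 1) t ≤ ∑' i : ℕ, g0 (i + 1)) ∧
  (∀ m : ℕ, ∀ t₁ t₂ : ℝ, 0 ≤ t₁ → t₁ ≤ t₂ →
    ∑' k : ℕ, ((m + 1 + k : ℕ) : ℝ) * g (m + 1 + k) t₂ ≤
      ∑' k : ℕ, ((m + 1 + k : ℕ) : ℝ) * g (m + 1 + k) t₁)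

open Finset in
lemma rbk_sigma_loss (A : ℕ → ℕ → ℝ) (σ : ℕ → ℝ) (hσ : ∀ i, 0 ≤ σ i)
    (hA : ∀ i j, 1 ≤ i → 1 ≤ j → 0 ≤ A i j) (hs : ∀ i j, 1 ≤ i → 1 ≤ j → A i j = A j i) (I : ℕ) :
    ∑ m ∈ Icc 1 I, ∑ j ∈ Ico 1 m, (σ m + σ j) * A m j ≤
      ∑ i ∈ Icc 1 I, σ i * ∑ j ∈ Icc 1 I, A i j := by
  induction I with
  | zero => simp
  | succ I ih =>
    rw [sum_Icc_succ_top (by omega), sum_Icc_succ_top (by omega)]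
    have e1 : ∑ i ∈ Icc 1 I, σ i * ∑ j ∈ Icc 1 (I+1), A i j
        = ∑ i ∈ Icc 1 I, σ i * ∑ j ∈ Icc 1 I, A i j + ∑ i ∈ Icc 1 I, σ i * A i (I+1) := by
      rw [← sum_add_distrib]
      refine sum_congr rfl fun i _ => ?_
      rw [sum_Icc_succ_top (by omega)]; ring
    have e2 : ∑ j ∈ Ico 1 (I+1), (σ (I+1) + σ j) * A (I+1) j
        = σ (I+1) * ∑ j ∈ Icc 1 I, A (I+1) j + ∑ i ∈ Icc 1 I, σ i * A i (I+1) := by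
      rw [mul_sum, ← sum_add_distrib]
      have : Ico 1 (I+1) = Icc 1 I := by ext; simp
      rw [this]
      refine sum_congr rfl fun i hi => ?_
      rw [hs i (I+1) (by simp at hi; omega) (by omega)]; ring
    rw [e1, e2, sum_Icc_succ_top (by omega)]
    have := mul_nonneg (hσ (I+1)) (hA (I+1) (I+1) (by omega) (by omega))
    nlinarith

open Finset in
lemma rbk_reindex (φ : ℕ → ℕ → ℝ) (I : ℕ) :
    ∑ i ∈ Icc 1 I, ∑ j ∈ range (I - i), φ (i + (j + 1)) (j + 1)
      = ∑ m ∈ Icc 1 I, ∑ j ∈ Ico 1 m, φ m j := by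
  rw [sum_sigma', sum_sigma']
  refine sum_bij' (fun p _ => ⟨p.1 + (p.2 + 1), p.2 + 1⟩) (fun p _ => ⟨p.1 - p.2, p.2 - 1⟩) ?_ ?_ ?_ ?_ ?_
  · rintro ⟨i, j⟩ h; simp at h ⊢; omega
  · rintro ⟨i, j⟩ h; simp at h ⊢; omega
  · rintro ⟨i, j⟩ h; simp at h ⊢
  · rintro ⟨i, j⟩ h; simp at h ⊢; omega
  · rintro ⟨i, j⟩ h; simp

open Finset in
lemma rbk_core (a : ℕ → ℕ → ℝ) (F : ℕ → ℝ) (ε ρ B : ℝ) (I : ℕ) (hε : 0 < ε) (hρ : 0 ≤ ρ) (hB : 0 ≤ B)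
    (hF : ∀ i, 1 ≤ i → 0 ≤ F i) (ha : ∀ i j, 1 ≤ i → 1 ≤ j → 0 ≤ a i j)
    (hs : ∀ i j, 1 ≤ i → 1 ≤ j → a i j = a j i)
    (htail : ∀ m j : ℕ, I < m → 1 ≤ j → j ≤ m → a m j ≤ ε * (ρ * (ε * m) * (1 + ε * j)))
    (hs1 : Summable (fun j : ℕ => F (j+1))) (hs2 : Summable (fun j : ℕ => ((j:ℝ)+1) * F (j+1)))
    (hB1 : ε * ∑' j : ℕ, F (j+1) ≤ B) (hB2 : ε * (ε * ∑' j : ℕ, ((j:ℝ)+1) * F (j+1)) ≤ B)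
    (hg : ∀ i, 1 ≤ i → Summable (fun j : ℕ => a (i + (j + 1)) (j + 1) * F (i + (j + 1)) * F (j + 1)))
    (hl : ∀ i, 1 ≤ i → Summable (fun j : ℕ => a i (j + 1) * F i * F (j + 1)))
    (σ : ℕ → ℝ) (hσ : ∀ i, 0 ≤ σ i) (hσ1 : ∀ i, σ i ≤ 1) :
    ∑ i ∈ Icc 1 I, σ i * ((∑' j : ℕ, a (i + (j + 1)) (j + 1) * F (i + (j + 1)) * F (j + 1)) -
        ∑' j : ℕ, a i (j + 1) * F i * F (j + 1)) ≤
      2 * ρ * B^2 / ε + ∑ m ∈ Icc 1 I, ∑ j ∈ Ico 1 m, (σ (m - j) - σ m - σ j) * (a m j * F m * F j) := by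
  set b : ℕ → ℕ → ℝ := fun i j => ε * ρ * (ε * ((i + (j+1) : ℕ):ℝ) * F (i + (j+1))) * ((1 + ε * ((j:ℝ)+1)) * F (j+1)) with hb
  have hb0 : ∀ i j, 0 ≤ b i j := by
    intro i j
    have := hF (i + (j+1)) (by omega)
    have := hF (j+1) (by omega)
    simp only [hb]; positivity
  have hsw : Summable (fun j : ℕ => (1 + ε * ((j:ℝ)+1)) * F (j+1)) := by
    refine (hs1.add (hs2.mul_left ε)).congr fun j => by ring
  have htw : ε * ∑' j : ℕ, (1 + ε * ((j:ℝ)+1)) * F (j+1) ≤ 2 * B := by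
    have : ∑' j : ℕ, (1 + ε * ((j:ℝ)+1)) * F (j+1) = ∑' j : ℕ, F (j+1) + ε * ∑' j : ℕ, ((j:ℝ)+1) * F (j+1) := by
      rw [← tsum_mul_left, ← hs1.tsum_add (hs2.mul_left ε)]
      exact tsum_congr fun j => by ring
    rw [this]; linarith
  have hcol : ∀ (s : Finset ℕ) j, ε * (ε * ∑ i ∈ s, ((i + (j+1) : ℕ):ℝ) * F (i + (j+1))) ≤ B := by
    intro s j
    refine le_trans ?_ hB2
    gcongr
    have h1 : ∑ i ∈ s, ((i + (j+1) : ℕ):ℝ) * F (i + (j+1)) = ∑ i ∈ s.map (addRightEmbedding j), ((i:ℝ)+1) * F (i+1) := by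
      rw [sum_map]
      refine sum_congr rfl fun i _ => ?_
      simp [add_assoc]
    rw [h1]
    exact hs2.sum_le_tsum _ fun i _ => mul_nonneg (by positivity) (hF _ (by omega))
  have hbS : ∀ i, Summable (b i) := by
    intro i
    refine Summable.of_nonneg_of_le (hb0 i) (fun j => ?_) (hsw.mul_left (ρ * B))
    have h1 := hcol {i} j
    simp only [sum_singleton] at h1
    have := hF (j+1) (by omega)
    simp only [hb]
    have h2 : 0 ≤ (1 + ε * ((j:ℝ)+1)) * F (j+1) := by positivity
    have h3 : ε * ρ * (ε * ((i + (j+1) : ℕ):ℝ) * F (i + (j+1))) ≤ ρ * B := by nlinarith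
    exact mul_le_mul_of_nonneg_right h3 h2
  have hgain : ∀ i ∈ Icc 1 I, (∑' j : ℕ, a (i + (j + 1)) (j + 1) * F (i + (j + 1)) * F (j + 1)) ≤
      ∑ j ∈ range (I - i), a (i + (j + 1)) (j + 1) * F (i + (j + 1)) * F (j + 1) + ∑' j, b i j := by
    intro i hi
    simp only [mem_Icc] at hi
    rw [← (hg i hi.1).sum_add_tsum_nat_add (I - i)]
    refine add_le_add le_rfl ?_
    have h4 : ∑' j, b i (j + (I - i)) ≤ ∑' j, b i j := by
      rw [← (hbS i).sum_add_tsum_nat_add (I - i)]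
      have := sum_nonneg (s := range (I - i)) fun j _ => hb0 i j
      linarith
    refine le_trans ?_ h4
    refine Summable.tsum_le_tsum (fun j => ?_) ((summable_nat_add_iff (I-i)).2 (hg i hi.1)) ((summable_nat_add_iff (I-i)).2 (hbS i))
    have h5 := htail (i + ((j + (I-i)) + 1)) ((j + (I-i)) + 1) (by omega) (by omega) (by omega)
    have h6 := hF (i + ((j + (I-i)) + 1)) (by omega)
    have h7 := hF ((j + (I-i)) + 1) (by omega)
    calc _ ≤ (ε * (ρ * (ε * ((i + ((j + (I-i)) + 1) : ℕ):ℝ)) * (1 + ε * (((j + (I-i)) + 1 : ℕ):ℝ)))) * F (i + ((j + (I-i)) + 1)) * F ((j + (I-i)) + 1) := by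
          gcongr
      _ = _ := by simp only [hb]; push_cast; ring
  have hloss : ∀ i ∈ Icc 1 I, ∑ j ∈ Icc 1 I, a i j * F i * F j ≤ ∑' j : ℕ, a i (j + 1) * F i * F (j + 1) := by
    intro i hi
    simp only [mem_Icc] at hi
    have : ∑ j ∈ Icc 1 I, a i j * F i * F j = ∑ j ∈ range I, a i (j+1) * F i * F (j+1) := by
      rw [range_eq_Ico, sum_Ico_add' (fun j => a i j * F i * F j)]
      congr 1
    rw [this]
    exact (hl i hi.1).sum_le_tsum _ fun j _ => mul_nonneg (mul_nonneg (ha _ _ hi.1 (by omega)) (hF _ hi.1)) (hF _ (by omega))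
  have htot : ∑ i ∈ Icc 1 I, ∑' j, b i j ≤ 2 * ρ * B^2 / ε := by
    rw [← Summable.tsum_finsetSum fun i _ => hbS i]
    calc _ ≤ ∑' j : ℕ, (ρ * B) * ((1 + ε * ((j:ℝ)+1)) * F (j+1)) := by
          refine Summable.tsum_le_tsum (fun j => ?_) (summable_sum fun i _ => hbS i) (hsw.mul_left _)
          have h1 := hcol (Icc 1 I) j
          have := hF (j+1) (by omega)
          have h2 : 0 ≤ (1 + ε * ((j:ℝ)+1)) * F (j+1) := by positivity
          simp only [hb]
          rw [← sum_mul]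
          refine mul_le_mul_of_nonneg_right ?_ h2
          have : ∑ i ∈ Icc 1 I, ε * ρ * (ε * ((i + (j+1) : ℕ):ℝ) * F (i + (j+1))) = ρ * (ε * (ε * ∑ i ∈ Icc 1 I, ((i + (j+1) : ℕ):ℝ) * F (i + (j+1)))) := by
            simp only [mul_sum]
            exact sum_congr rfl fun i _ => by ring
          rw [this]
          gcongr
      _ ≤ _ := by
          rw [tsum_mul_left, le_div_iff₀ hε]
          have : ρ * B * (ε * ∑' j : ℕ, (1 + ε * ((j:ℝ)+1)) * F (j+1)) ≤ ρ * B * (2 * B) := by gcongr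
          linarith
  have hA := rbk_sigma_loss (fun i j => a i j * F i * F j) σ hσ
    (fun i j hi hj => mul_nonneg (mul_nonneg (ha _ _ hi hj) (hF _ hi)) (hF _ hj))
    (fun i j hi hj => by simp only [hs i j hi hj]; ring) I
  have hR := rbk_reindex (fun m j => σ (m - j) * (a m j * F m * F j)) I
  calc _ ≤ ∑ i ∈ Icc 1 I, (σ i * ∑ j ∈ range (I - i), a (i + (j + 1)) (j + 1) * F (i + (j + 1)) * F (j + 1) + ∑' j, b i j - σ i * ∑ j ∈ Icc 1 I, a i j * F i * F j) := by
        refine sum_le_sum fun i hi => ?_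
        have h1 := mul_le_mul_of_nonneg_left (hgain i hi) (hσ i)
        have h2 := mul_le_mul_of_nonneg_left (hloss i hi) (hσ i)
        have h3 : σ i * ∑' j, b i j ≤ 1 * ∑' j, b i j := mul_le_mul_of_nonneg_right (hσ1 i) (tsum_nonneg (hb0 i))
        linarith
    _ = ∑ i ∈ Icc 1 I, (σ i * ∑ j ∈ range (I - i), a (i + (j + 1)) (j + 1) * F (i + (j + 1)) * F (j + 1)) + ∑ i ∈ Icc 1 I, ∑' j, b i j - ∑ i ∈ Icc 1 I, σ i * ∑ j ∈ Icc 1 I, a i j * F i * F j := by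
        rw [sum_sub_distrib, sum_add_distrib]
    _ ≤ ∑ m ∈ Icc 1 I, ∑ j ∈ Ico 1 m, σ (m-j) * (a m j * F m * F j) + 2 * ρ * B^2 / ε - ∑ m ∈ Icc 1 I, ∑ j ∈ Ico 1 m, (σ m + σ j) * (a m j * F m * F j) := by
        have : ∑ i ∈ Icc 1 I, (σ i * ∑ j ∈ range (I - i), a (i + (j + 1)) (j + 1) * F (i + (j + 1)) * F (j + 1)) = ∑ m ∈ Icc 1 I, ∑ j ∈ Ico 1 m, σ (m-j) * (a m j * F m * F j) := by
          rw [← hR]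
          refine sum_congr rfl fun i _ => ?_
          rw [mul_sum]
          refine sum_congr rfl fun j _ => ?_
          simp
        rw [this]
        linarith
    _ = _ := by
        rw [add_sub_right_comm, ← sum_sub_distrib, add_comm]
        congr 1
        refine sum_congr rfl fun m _ => ?_
        rw [← sum_sub_distrib]
        exact sum_congr rfl fun j _ => by ring

lemma rbk_pos_deriv (u : ℝ → ℝ) (u' t : ℝ) (h : HasDerivWithinAt u u' (Set.Ici t) t) :
    ∃ σ : ℝ, (σ = 0 ∨ σ = 1) ∧ (σ = 1 → 0 ≤ u t) ∧ (σ = 0 → u t ≤ 0) ∧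
      HasDerivWithinAt (fun s => max (u s) 0) (σ * u') (Set.Ici t) t := by
  rcases lt_trichotomy (u t) 0 with h0 | h0 | h0
  · refine ⟨0, Or.inl rfl, by simp, fun _ => h0.le, ?_⟩
    have he : ∀ᶠ s in nhdsWithin t (Set.Ici t), u s < 0 := h.continuousWithinAt.eventually (gt_mem_nhds h0)
    have h2 := (hasDerivWithinAt_const t (Set.Ici t) (0:ℝ))
    rw [zero_mul]
    refine h2.congr_of_eventuallyEq ?_ (by simp [h0.le])
    filter_upwards [he] with s hs
    simp [hs.le]
  · refine ⟨if 0 < u' then 1 else 0, by split_ifs <;> simp, fun _ => h0.ge, fun _ => h0.le, ?_⟩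
    have e : (if 0 < u' then (1:ℝ) else 0) * u' = max u' 0 := by
      split_ifs with h3
      · simp [h3.le]
      · simp [not_lt.1 h3]
    rw [e]
    rw [hasDerivWithinAt_iff_tendsto_slope] at h ⊢
    have h4 : Filter.Tendsto (fun s => max (slope u t s) 0) (nhdsWithin t (Set.Ici t \ {t})) (nhds (max u' 0)) := h.max tendsto_const_nhds
    refine h4.congr' ?_
    filter_upwards [self_mem_nhdsWithin] with s hs
    have hst : t < s := lt_of_le_of_ne hs.1 (fun h => hs.2 h.symm)
    have : 0 < (s - t)⁻¹ := inv_pos.2 (by linarith)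
    simp only [slope, h0, vsub_eq_sub, smul_eq_mul, max_self, sub_zero]
    rw [mul_max_of_nonneg _ _ this.le, mul_zero]
  · refine ⟨1, Or.inr rfl, fun _ => h0.le, by simp, ?_⟩
    have he : ∀ᶠ s in nhdsWithin t (Set.Ici t), 0 < u s := h.continuousWithinAt.eventually (lt_mem_nhds h0)
    rw [one_mul]
    refine h.congr_of_eventuallyEq ?_ (by simp [h0.le])
    filter_upwards [he] with s hs
    simp [hs.le]

lemma rbk_bins (s : ℕ → ℝ) (hs : ∀ k, s (k+1) ≤ s k) (x : ℝ) (n : ℕ) :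
    ∑ k ∈ Finset.range n, (if s (k+1) ≤ x ∧ x < s k then (1:ℝ) else 0) ≤ 1 := by
  have : ∑ k ∈ Finset.range n, (if s (k+1) ≤ x ∧ x < s k then (1:ℝ) else 0) ≤ if s n ≤ x then 1 else 0 := by
    induction n with
    | zero => simp; split_ifs <;> norm_num
    | succ n ih =>
      rw [Finset.sum_range_succ]
      have := hs n
      split_ifs at ih ⊢ <;> grind
  refine this.trans ?_
  split_ifs <;> norm_num

lemma rbk_kernel_tail 
    (K : ℝ → ℝ → ℝ) (r : ℝ → ℝ) (α : ℝ → ℝ → ℝ) (A : ℝ) (hA : 0 < A)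
    (hK_symm : ∀ x y : ℝ, 0 < x → 0 < y → K x y = K y x)
    (hr_nonneg : ∀ x : ℝ, 0 < x → 0 ≤ r x)
    (hK_form : ∀ x y : ℝ, 0 < x → 0 < y → K x y = r x * r y + α x y)
    (hα_bound : ∀ x y : ℝ, 1 ≤ x → 1 ≤ y → α x y ≤ A * r x * r y)
    (ω : ℝ → ℝ → ℝ)
    (hω_bound : ∀ R : ℝ, 1 ≤ R → ∀ y : ℝ, 0 < y → ∀ x : ℝ, 0 < x → x ≤ R → K x y / y ≤ ω R y)
    (hω_lim : ∀ R : ℝ, 1 ≤ R → Filter.Tendsto (ω R) Filter.atTop (nhds 0))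
    (Ω : ℝ → ℝ)
    (hΩ_bound : ∀ R : ℝ, 1 ≤ R → ∀ x : ℝ, R ≤ x → r x / x ≤ Ω R)
    (hΩ_lim : Filter.Tendsto Ω Filter.atTop (nhds 0)) (ρ : ℝ) (hρ : 0 < ρ) :
    ∃ L0 : ℝ, 1 ≤ L0 ∧ ∀ x, L0 ≤ x → ∀ y, 0 < y → y ≤ x → K x y ≤ ρ * x * (1 + y) := by
  obtain ⟨c, hc, hc1, hc2⟩ : ∃ c : ℝ, 0 < c ∧ c ≤ 1 ∧ (1 + A) * c ≤ ρ :=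
    ⟨min 1 (ρ / (1 + A)), by positivity, min_le_left _ _, by
      have := min_le_right 1 (ρ / (1 + A))
      rw [le_div_iff₀ (by linarith)] at this
      linarith⟩
  obtain ⟨R, hR, hR1⟩ := ((hΩ_lim.eventually (gt_mem_nhds hc)).and (Filter.eventually_ge_atTop 1)).exists
  obtain ⟨X, hX⟩ := Filter.eventually_atTop.1 ((hω_lim R hR1).eventually (gt_mem_nhds hρ))
  refine ⟨max 1 X, le_max_left _ _, fun x hx y hy hyx => ?_⟩
  have hx1 : 1 ≤ x := (le_max_left _ _).trans hx
  have hx0 : 0 < x := by linarith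
  rcases le_or_gt R y with h | h
  · have h1 := hΩ_bound R hR1 x (h.trans hyx)
    have h2 := hΩ_bound R hR1 y h
    rw [div_le_iff₀ (by assumption)] at h1 h2
    have h3 : r x ≤ c * x := h1.trans (by gcongr)
    have h4 : r y ≤ c * y := h2.trans (by gcongr)
    have h5 : r x * r y ≤ (c * x) * (c * y) := mul_le_mul h3 h4 (hr_nonneg y hy) (by positivity)
    have h6 := hα_bound x y hx1 (hR1.trans h)
    rw [hK_form x y hx0 hy]
    calc _ ≤ (1 + A) * (r x * r y) := by linarith
      _ ≤ (1 + A) * ((c * x) * (c * y)) := by gcongr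
      _ = ((1 + A) * c) * c * (x * y) := by ring
      _ ≤ ρ * 1 * (x * y) := by gcongr
      _ ≤ _ := by nlinarith [mul_pos hρ hx0]
  · have h1 := hω_bound R hR1 x hx0 y hy h.le
    have h2 := hX x ((le_max_right _ _).trans hx)
    rw [div_le_iff₀ hx0] at h1
    rw [hK_symm x y hx0 hy]
    calc _ ≤ _ := h1
      _ ≤ ρ * x := by gcongr
      _ ≤ _ := by nlinarith [mul_pos (mul_pos hρ hx0) hy]

open Finset in
lemma rbk_card (ε s c : ℝ) (hε : 0 < ε) (hs : 0 ≤ s) (hc : 0 ≤ c) (I : ℕ) :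
    ∑ i ∈ Icc 1 I, (if s ≤ ε * i then 0 else c) ≤ s / ε * c := by
  have h0 : 0 ≤ s / ε := by positivity
  calc _ ≤ ∑ i ∈ Icc 1 ⌊s / ε⌋₊, c := by
        rw [← sum_filter_add_sum_filter_not (Icc 1 I) (fun i : ℕ => s ≤ ε * i)]
        rw [sum_ite_of_true (by simp), sum_ite_of_false (by simp)]
        simp only [sum_const_zero, zero_add]
        refine sum_le_sum_of_subset_of_nonneg ?_ (fun _ _ _ => hc)
        intro i hi
        simp only [mem_filter, mem_Icc, not_le] at hi ⊢
        refine ⟨hi.1.1, Nat.le_floor ?_⟩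
        rw [le_div_iff₀ hε]; linarith [hi.2]
    _ = (⌊s / ε⌋₊ : ℝ) * c := by simp
    _ ≤ _ := by gcongr; exact Nat.floor_le h0

open Finset in
lemma rbk_H (a : ℕ → ℕ → ℝ) (F G : ℕ → ℝ) (ε B : ℝ) (I : ℕ) (hε : 0 < ε) (hB : 0 ≤ B) (Tl : ℝ)
    (hF : ∀ i, 1 ≤ i → 0 ≤ F i) (ha : ∀ i j, 1 ≤ i → 1 ≤ j → 0 ≤ a i j)
    (hs1 : Summable (fun j : ℕ => F (j+1)))
    (hB1 : ε * ∑' j : ℕ, F (j+1) ≤ B)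
    (σ : ℕ → ℝ) (hσ : ∀ i, σ i = 0 ∨ σ i = 1) (s s' M C : ℝ) (hs' : 0 ≤ s') (hM : 0 ≤ M) (hC : 0 ≤ C)
    (hσ0 : ∀ i ∈ Icc 1 I, σ i = 0 → F i ≤ if s' ≤ ε * i then M else 0)
    (hCa : ∀ m j : ℕ, 1 ≤ j → j < m → m ≤ I → s ≤ ε * j → a m j ≤ ε * C)
    (hcore : ∑ i ∈ Icc 1 I, σ i * G i ≤ Tl + ∑ m ∈ Icc 1 I, ∑ j ∈ Ico 1 m, (σ (m - j) - σ m - σ j) * (a m j * F m * F j)) :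
    ∑ i ∈ Icc 1 I, σ i * (G i - if s' ≤ ε * i then C * B * M else 0) ≤
      Tl + s' * C * M * B / ε + ∑ m ∈ Icc 1 I, ∑ j ∈ Ico 1 m, (if s' ≤ ε * j ∧ ε * j < s then 1 else 0) * (a m j * F m * F j) := by
  have hσn : ∀ i, 0 ≤ σ i := fun i => by rcases hσ i with h | h <;> simp [h]
  have hσ1 : ∀ i, σ i ≤ 1 := fun i => by rcases hσ i with h | h <;> simp [h]
  have h1 : ∑ m ∈ Icc 1 I, ∑ j ∈ Ico 1 m, (σ (m - j) - σ m - σ j) * (a m j * F m * F j) ≤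
      ∑ m ∈ Icc 1 I, ∑ j ∈ Ico 1 m, (if s' ≤ ε * j ∧ ε * j < s then 1 else 0) * (a m j * F m * F j)
      + ∑ m ∈ Icc 1 I, ∑ j ∈ Ico 1 m, σ (m - j) * (ε * C * M * F j) := by
    rw [← sum_add_distrib]
    refine sum_le_sum fun m hm => ?_
    rw [← sum_add_distrib]
    refine sum_le_sum fun j hj => ?_
    simp only [mem_Icc, mem_Ico] at hm hj
    have hFj := hF j hj.1
    have hFm := hF m hm.1
    have haj := ha m j hm.1 hj.1
    have hA : 0 ≤ a m j * F m * F j := by positivity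
    have hr : 0 ≤ σ (m-j) * (ε * C * M * F j) := mul_nonneg (hσn _) (by positivity)
    have hl : 0 ≤ (if s' ≤ ε * j ∧ ε * j < s then (1:ℝ) else 0) * (a m j * F m * F j) := by
      split_ifs <;> simp [hA]
    by_cases hz : σ m = 0 ∧ σ j = 0
    · have hm0 := hσ0 m (by simp; omega) hz.1
      have hj0 := hσ0 j (by simp; omega) hz.2
      rw [hz.1, hz.2, sub_zero, sub_zero]
      by_cases hjs : s' ≤ ε * j
      · by_cases hjs2 : ε * j < s
        · rw [if_pos ⟨hjs, hjs2⟩]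
          have : σ (m-j) * (a m j * F m * F j) ≤ 1 * (a m j * F m * F j) := mul_le_mul_of_nonneg_right (hσ1 _) hA
          linarith
        · have h3 := hCa m j hj.1 hj.2 hm.2 (not_lt.1 hjs2)
          have h4 : F m ≤ M := hm0.trans (by split_ifs <;> linarith)
          have : a m j * F m * F j ≤ ε * C * M * F j := by gcongr
          have := mul_le_mul_of_nonneg_left this (hσn (m-j))
          linarith
      · rw [if_neg hjs] at hj0
        have : F j = 0 := le_antisymm hj0 hFj
        rw [this]; simp
    · have h5 : σ (m-j) - σ m - σ j ≤ 0 := by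
        have h9 := hσ1 (m-j)
        rcases hσ m with h | h
        · rcases hσ j with h2 | h2
          · exact absurd ⟨h, h2⟩ hz
          · rw [h, h2]; linarith
        · have := hσn j
          rw [h]; linarith
      have := mul_nonpos_of_nonpos_of_nonneg h5 hA
      linarith
  have h2 : ∑ m ∈ Icc 1 I, ∑ j ∈ Ico 1 m, σ (m - j) * (ε * C * M * F j) ≤ ∑ i ∈ Icc 1 I, σ i * (C * B * M) := by
    rw [← rbk_reindex (fun m j => σ (m - j) * (ε * C * M * F j))]
    refine sum_le_sum fun i _ => ?_
    simp only [Nat.add_sub_cancel]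
    rw [← mul_sum, ← mul_sum]
    refine mul_le_mul_of_nonneg_left ?_ (hσn i)
    have h6 : ∑ j ∈ range (I - i), F (j+1) ≤ ∑' j, F (j+1) := hs1.sum_le_tsum _ fun j _ => hF _ (by omega)
    calc _ ≤ ε * C * M * ∑' j, F (j+1) := by gcongr
      _ = C * M * (ε * ∑' j, F (j+1)) := by ring
      _ ≤ C * M * B := by gcongr
      _ = _ := by ring
  have h3 : ∑ i ∈ Icc 1 I, σ i * (C * B * M) - ∑ i ∈ Icc 1 I, σ i * (if s' ≤ ε * i then C * B * M else 0) ≤ s' * C * M * B / ε := by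
    rw [← sum_sub_distrib]
    calc _ ≤ ∑ i ∈ Icc 1 I, (if s' ≤ ε * i then 0 else C * B * M) := by
          refine sum_le_sum fun i _ => ?_
          split_ifs
          · simp
          · have : 0 ≤ C * B * M := by positivity
            nlinarith [hσ1 i]
      _ ≤ s' / ε * (C * B * M) := rbk_card ε s' _ hε hs' (by positivity) I
      _ = _ := by ring
  have h4 : ∑ i ∈ Icc 1 I, σ i * (G i - if s' ≤ ε * i then C * B * M else 0) = ∑ i ∈ Icc 1 I, σ i * G i - ∑ i ∈ Icc 1 I, σ i * (if s' ≤ ε * i then C * B * M else 0) := by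
    rw [← sum_sub_distrib]
    exact sum_congr rfl fun i _ => by ring
  rw [h4]
  linarith

open Finset in
lemma rbk_dyn (a : ℕ → ℕ → ℝ) (g : ℕ → ℝ → ℝ) (ε ρ B M0 T : ℝ) (I n : ℕ) (hε : 0 < ε) (hρ : 0 ≤ ρ) (hB : 0 ≤ B)
    (hM0 : 0 ≤ M0) 
    (s C : ℕ → ℝ) (hs : ∀ k, 0 ≤ s k) (hsa : ∀ k, s (k+1) ≤ s k) (hC : ∀ k, 0 ≤ C k)
    (hF : ∀ i, 1 ≤ i → ∀ t, 0 ≤ t → 0 ≤ g i t) (ha : ∀ i j, 1 ≤ i → 1 ≤ j → 0 ≤ a i j)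
    (hsy : ∀ i j, 1 ≤ i → 1 ≤ j → a i j = a j i)
    (htail : ∀ m j : ℕ, I < m → 1 ≤ j → j ≤ m → a m j ≤ ε * (ρ * (ε * m) * (1 + ε * j)))
    (hCa : ∀ k, ∀ m j : ℕ, 1 ≤ j → j < m → m ≤ I → s k ≤ ε * j → a m j ≤ ε * C k)
    (hs1 : ∀ t, 0 ≤ t → Summable (fun j : ℕ => g (j+1) t)) (hs2 : ∀ t, 0 ≤ t → Summable (fun j : ℕ => ((j:ℝ)+1) * g (j+1) t))
    (hB1 : ∀ t, 0 ≤ t → ε * ∑' j : ℕ, g (j+1) t ≤ B) (hB2 : ∀ t, 0 ≤ t → ε * (ε * ∑' j : ℕ, ((j:ℝ)+1) * g (j+1) t) ≤ B)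
    (hd : ∀ i : ℕ, 1 ≤ i → ∀ t : ℝ, 0 ≤ t →
    Summable (fun j : ℕ => a (i + (j + 1)) (j + 1) * g (i + (j + 1)) t * g (j + 1) t) ∧
    Summable (fun j : ℕ => a i (j + 1) * g i t * g (j + 1) t) ∧
    HasDerivWithinAt (g i)
      ((∑' j : ℕ, a (i + (j + 1)) (j + 1) * g (i + (j + 1)) t * g (j + 1) t) -
        ∑' j : ℕ, a i (j + 1) * g i t * g (j + 1) t) (Set.Ici 0) t) (t : ℝ) (ht0 : 0 ≤ t) (htT : t ≤ T) :
    ∑ k ∈ range n, ∑ i ∈ Icc 1 I, max (g i t - if s (k+1) ≤ ε * i then M0 * Real.exp (C k * B * t) else 0) 0 ≤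
      ∑ i ∈ Icc 1 I, g i 0 + ∑ k ∈ range n, ∑ i ∈ Icc 1 I, max (g i 0 - if s (k+1) ≤ ε * i then M0 else 0) 0 +
       t * ((n+1) * (2 * ρ * B^2 / ε) + ∑ k ∈ range n, s (k+1) * C k * (M0 * Real.exp (C k * B * T)) * B / ε) := by
  set c := ((n:ℝ)+1) * (2 * ρ * B^2 / ε) + ∑ k ∈ range n, s (k+1) * C k * (M0 * Real.exp (C k * B * T)) * B / ε with hc
  set V : ℝ → ℝ := fun t => ∑ i ∈ Icc 1 I, g i t + ∑ k ∈ range n, ∑ i ∈ Icc 1 I, max (g i t - if s (k+1) ≤ ε * i then M0 * Real.exp (C k * B * t) else 0) 0 with hV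
  have key : ∀ x, ∃ d, 0 ≤ x → x ≤ T → HasDerivWithinAt V d (Set.Ici x) x ∧ d ≤ c := by
    intro x
    by_cases hx : 0 ≤ x ∧ x ≤ T
    swap
    · exact ⟨0, fun h1 h2 => absurd ⟨h1, h2⟩ hx⟩
    obtain ⟨hx, hxT⟩ := hx
    set G : ℕ → ℝ := fun i => (∑' j : ℕ, a (i + (j + 1)) (j + 1) * g (i + (j + 1)) x * g (j + 1) x) -
        ∑' j : ℕ, a i (j + 1) * g i x * g (j + 1) x with hG
    have hgd : ∀ i, 1 ≤ i → HasDerivWithinAt (g i) (G i) (Set.Ici x) x := fun i hi =>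
      (hd i hi x hx).2.2.mono (Set.Ici_subset_Ici.2 hx)
    have hud : ∀ k i, 1 ≤ i → HasDerivWithinAt (fun t => g i t - if s (k+1) ≤ ε * i then M0 * Real.exp (C k * B * t) else 0)
        (G i - if s (k+1) ≤ ε * i then C k * B * (M0 * Real.exp (C k * B * x)) else 0) (Set.Ici x) x := by
      intro k i hi
      refine (hgd i hi).sub ?_
      split_ifs
      · have h1 : HasDerivAt (fun t => M0 * Real.exp (C k * B * t)) (M0 * (Real.exp (C k * B * x) * (C k * B * 1))) x :=
          (((hasDerivAt_id x).const_mul (C k * B)).exp).const_mul M0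
        convert h1.hasDerivWithinAt using 1
        ring
      · exact hasDerivWithinAt_const _ _ _
    have hσex : ∀ k i, ∃ σ : ℝ, (σ = 0 ∨ σ = 1) ∧ (1 ≤ i → (σ = 0 → g i x ≤ if s (k+1) ≤ ε * i then M0 * Real.exp (C k * B * x) else 0) ∧
        HasDerivWithinAt (fun t => max (g i t - if s (k+1) ≤ ε * i then M0 * Real.exp (C k * B * t) else 0) 0)
        (σ * (G i - if s (k+1) ≤ ε * i then C k * B * (M0 * Real.exp (C k * B * x)) else 0)) (Set.Ici x) x) := by
      intro k i
      by_cases hi : 1 ≤ i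
      · obtain ⟨σ, h1, h2, h3, h4⟩ := rbk_pos_deriv _ _ _ (hud k i hi)
        exact ⟨σ, h1, fun _ => ⟨fun h => by linarith [h3 h], h4⟩⟩
      · exact ⟨0, Or.inl rfl, fun h => absurd h hi⟩
    choose σ hσ hσ2 using hσex
    refine ⟨∑ i ∈ Icc 1 I, G i + ∑ k ∈ range n, ∑ i ∈ Icc 1 I, σ k i * (G i - if s (k+1) ≤ ε * i then C k * B * (M0 * Real.exp (C k * B * x)) else 0), fun _ _ => ⟨?_, ?_⟩⟩
    · refine HasDerivWithinAt.add ?_ ?_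
      · exact HasDerivWithinAt.fun_sum fun i hi => hgd i (mem_Icc.1 hi).1
      · exact HasDerivWithinAt.fun_sum fun k _ => HasDerivWithinAt.fun_sum fun i hi => (hσ2 k i (mem_Icc.1 hi).1).2
    · have hcore := fun σ h1 h2 => rbk_core a (fun i => g i x) ε ρ B I hε hρ hB (fun i hi => hF i hi x hx) ha hsy htail (hs1 x hx) (hs2 x hx)
        (hB1 x hx) (hB2 x hx) (fun i hi => (hd i hi x hx).1) (fun i hi => (hd i hi x hx).2.1) σ h1 h2
      have hS := hcore (fun _ => 1) (by simp) (by simp)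
      have hS' : ∑ i ∈ Icc 1 I, G i ≤ 2 * ρ * B^2 / ε - ∑ m ∈ Icc 1 I, ∑ j ∈ Ico 1 m, a m j * g m x * g j x := by
        simp only [one_mul, sub_self, zero_sub, neg_mul, sum_neg_distrib] at hS
        linarith
      have hH : ∀ k ∈ range n, ∑ i ∈ Icc 1 I, σ k i * (G i - if s (k+1) ≤ ε * i then C k * B * (M0 * Real.exp (C k * B * x)) else 0)
          ≤ (2 * ρ * B^2 / ε + s (k+1) * C k * (M0 * Real.exp (C k * B * T)) * B / ε) + ∑ m ∈ Icc 1 I, ∑ j ∈ Ico 1 m, (if s (k+1) ≤ ε * j ∧ ε * j < s k then 1 else 0) * (a m j * g m x * g j x) := by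
        intro k _
        have h01 : ∀ i, 0 ≤ σ k i := fun i => by rcases hσ k i with h | h <;> simp [h]
        have h02 : ∀ i, σ k i ≤ 1 := fun i => by rcases hσ k i with h | h <;> simp [h]
        have h7 := rbk_H a (fun i => g i x) G ε B I hε hB (2 * ρ * B^2 / ε) (fun i hi => hF i hi x hx) ha (hs1 x hx) (hB1 x hx)
          (σ k) (hσ k) (s k) (s (k+1)) (M0 * Real.exp (C k * B * x)) (C k) (hs _) (by positivity) (hC k)
          (fun i hi => (hσ2 k i (mem_Icc.1 hi).1).1) (hCa k) (hcore (σ k) h01 h02)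
        refine h7.trans ?_
        have := hs (k+1)
        have := hC k
        gcongr
      have hH2 := sum_le_sum hH
      rw [sum_add_distrib, sum_add_distrib] at hH2
      have hbin : ∑ k ∈ range n, ∑ m ∈ Icc 1 I, ∑ j ∈ Ico 1 m, (if s (k+1) ≤ ε * j ∧ ε * j < s k then 1 else 0) * (a m j * g m x * g j x)
          ≤ ∑ m ∈ Icc 1 I, ∑ j ∈ Ico 1 m, a m j * g m x * g j x := by
        rw [sum_comm]
        refine sum_le_sum fun m hm => ?_
        rw [sum_comm]
        refine sum_le_sum fun j hj => ?_
        simp only [mem_Icc, mem_Ico] at hm hj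
        have hA : 0 ≤ a m j * g m x * g j x := mul_nonneg (mul_nonneg (ha m j hm.1 hj.1) (hF m hm.1 x hx)) (hF j hj.1 x hx)
        rw [← sum_mul]
        calc _ ≤ 1 * (a m j * g m x * g j x) := mul_le_mul_of_nonneg_right (rbk_bins s hsa (ε * j) n) hA
          _ = _ := one_mul _
      have : ∑ k ∈ range n, 2 * ρ * B^2 / ε = n * (2 * ρ * B^2 / ε) := by simp
      rw [this] at hH2
      rw [hc]
      linarith
  choose d hdd using key
  have hVc : ContinuousOn V (Set.Icc 0 T) := by
    have hgc : ∀ i, 1 ≤ i → ContinuousOn (g i) (Set.Icc 0 T) := fun i hi x hx =>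
      ((hd i hi x hx.1).2.2.continuousWithinAt).mono Set.Icc_subset_Ici_self
    refine ContinuousOn.add (continuousOn_finsetSum _ fun i hi => hgc i (mem_Icc.1 hi).1) ?_
    refine continuousOn_finsetSum _ fun k _ => continuousOn_finsetSum _ fun i hi => ?_
    refine ContinuousOn.sup ((hgc i (mem_Icc.1 hi).1).sub ?_) continuousOn_const
    split_ifs
    · fun_prop
    · exact continuousOn_const
  have hfin := image_le_of_deriv_right_le_deriv_boundary (f := V) (f' := d) (a := 0) (b := T) hVc
    (fun x hx => (hdd x hx.1 hx.2.le).1) (B := fun x => V 0 + x * c) (B' := fun _ => c) (by simp) (by fun_prop)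
    (fun x _ => by simpa using (((hasDerivAt_id x).mul_const c).const_add (V 0)).hasDerivWithinAt)
    (fun x hx => (hdd x hx.1 hx.2.le).2) (x := t) ⟨ht0, htT⟩
  have hpos : 0 ≤ ∑ i ∈ Icc 1 I, g i t := sum_nonneg fun i hi => hF i (mem_Icc.1 hi).1 t ht0
  simp only [hV, mul_zero, Real.exp_zero, mul_one] at hfin
  linarith

lemma rbk_cell_sub (ε : ℝ) (hε : 0 < ε) (i : ℕ) (hi : 1 ≤ i) : cell ε i ⊆ Set.Ioi 0 := by
  intro x hx
  have h1 : (1:ℝ) ≤ i := by exact_mod_cast hi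
  have : 0 < ((i:ℝ) - 1/2) * ε := mul_pos (by linarith) hε
  exact lt_of_lt_of_le this hx.1

lemma rbk_cell_uniq (ε : ℝ) (hε : 0 < ε) (i j : ℕ) (x : ℝ) (hi : x ∈ cell ε i) (hj : x ∈ cell ε j) : i = j := by
  have key : ∀ i j : ℕ, x ∈ cell ε i → x ∈ cell ε j → i ≤ j := by
    intro i j hi hj
    by_contra h
    have h1 : (j:ℝ) + 1 ≤ i := by exact_mod_cast not_le.1 h
    have h2 := hi.1
    have h3 := hj.2
    have : ((j:ℝ) + 1/2) * ε ≤ ((i:ℝ) - 1/2) * ε := by gcongr; linarith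
    linarith
  exact le_antisymm (key i j hi hj) (key j i hj hi)

lemma rbk_cell_meas (ε : ℝ) (i : ℕ) : MeasurableSet (cell ε i) := measurableSet_Ico

lemma rbk_cell_vol (ε : ℝ) (i : ℕ) : volume (cell ε i) = ENNReal.ofReal ε := by
  rw [cell, Real.volume_Ico]; congr 1; ring

lemma rbk_cellsum (φ : ℝ → ℝ) (hφ : IntegrableOn φ (Set.Ioi 0)) (h0 : ∀ x, 0 < x → 0 ≤ φ x) (ε : ℝ) (hε : 0 < ε)
    (s : Finset ℕ) (hs : ∀ i ∈ s, 1 ≤ i) :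
    ∑ i ∈ s, ∫ x in cell ε i, φ x ≤ ∫ x in Set.Ioi 0, φ x := by
  rw [← integral_biUnion_finset s (fun i _ => rbk_cell_meas ε i) ?_
    (fun i hi => hφ.mono_set (rbk_cell_sub ε hε i (hs i hi)))]
  · refine setIntegral_mono_set hφ ?_ ?_
    · filter_upwards [ae_restrict_mem measurableSet_Ioi] with x hx using h0 x hx
    · exact (Set.iUnion₂_subset fun i hi => rbk_cell_sub ε hε i (hs i hi)).eventuallyLE
  · intro i _ j _ hij
    exact Set.disjoint_left.2 fun x hx hy => hij (rbk_cell_uniq ε hε i j x hx hy)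

lemma rbk_fin_int (fin : ℝ → ℝ)
    (hfin_int : IntegrableOn (fun x => (1 + x) * fin x) (Set.Ioi 0)) : IntegrableOn fin (Set.Ioi 0) := by
  have h1 : IntegrableOn (fun x => (1 + x)⁻¹ * ((1 + x) * fin x)) (Set.Ioi 0) := by
    refine hfin_int.bdd_mul (c := 1) (by fun_prop) ?_
    filter_upwards [ae_restrict_mem measurableSet_Ioi] with x hx
    have : (0:ℝ) < x := hx
    rw [norm_inv, Real.norm_of_nonneg (by linarith)]
    exact inv_le_one_of_one_le₀ (by linarith)
  refine h1.congr_fun (fun x hx => ?_) measurableSet_Ioi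
  have : (0:ℝ) < x := hx
  field_simp

lemma rbk_trunc (fin : ℝ → ℝ) (hf : IntegrableOn fin (Set.Ioi 0)) (δ : ℝ) (hδ : 0 < δ) :
    ∃ M0 : ℝ, 0 ≤ M0 ∧ ∫ x in Set.Ioi 0, max (fin x - M0) 0 < δ := by
  have h : Filter.Tendsto (fun n : ℕ => ∫ x in Set.Ioi (0:ℝ), max (fin x - n) 0) Filter.atTop
      (nhds (∫ x in Set.Ioi (0:ℝ), (0:ℝ))) := by
    refine tendsto_integral_of_dominated_convergence (fun x => |fin x|) (fun n => ?_) hf.abs (fun n => ?_) ?_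
    · exact (hf.aestronglyMeasurable.sub aestronglyMeasurable_const).sup aestronglyMeasurable_const
    · refine Filter.Eventually.of_forall fun x => ?_
      have hn : (0:ℝ) ≤ n := n.cast_nonneg
      rw [Real.norm_of_nonneg (le_max_right _ _)]
      exact max_le (by linarith [le_abs_self (fin x)]) (abs_nonneg _)
    · refine Filter.Eventually.of_forall fun x => ?_
      refine tendsto_const_nhds.congr' ?_
      obtain ⟨N, hN⟩ := exists_nat_ge (fin x)
      filter_upwards [Filter.eventually_ge_atTop N] with n hn
      have : (N:ℝ) ≤ n := by exact_mod_cast hn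
      rw [max_eq_right (by linarith)]
  rw [integral_zero] at h
  obtain ⟨n, hn⟩ := (h.eventually (gt_mem_nhds hδ)).exists
  exact ⟨n, n.cast_nonneg, hn⟩

open Finset in
lemma rbk_init (fin : ℝ → ℝ) (hf : IntegrableOn fin (Set.Ioi 0)) (M0 ε s : ℝ) (hM : 0 ≤ M0) (hε : 0 < ε) (hs : 0 ≤ s) (I : ℕ) :
    ε * ∑ i ∈ Icc 1 I, max ((ε⁻¹ * ∫ x in cell ε i, fin x) - if s ≤ ε * i then M0 else 0) 0 ≤
      (∫ x in Set.Ioi 0, max (fin x - M0) 0) + M0 * s := by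
  have hi0 : IntegrableOn (fun x => max (fin x - M0) 0) (Set.Ioi 0) := by
    refine Integrable.mono' hf.abs ((hf.aestronglyMeasurable.sub aestronglyMeasurable_const).sup aestronglyMeasurable_const) ?_
    refine Filter.Eventually.of_forall fun x => ?_
    rw [Real.norm_of_nonneg (le_max_right _ _)]
    exact max_le (by linarith [le_abs_self (fin x)]) (abs_nonneg _)
  have h1 : ∀ i ∈ Icc 1 I, max ((ε⁻¹ * ∫ x in cell ε i, fin x) - if s ≤ ε * i then M0 else 0) 0 ≤
      ε⁻¹ * (∫ x in cell ε i, max (fin x - M0) 0) + if s ≤ ε * i then 0 else M0 := by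
    intro i hi
    have hsub := rbk_cell_sub ε hε i (mem_Icc.1 hi).1
    have hfin : volume (cell ε i) ≠ ⊤ := by rw [rbk_cell_vol]; exact ENNReal.ofReal_ne_top
    have hc : IntegrableOn (fun _ : ℝ => M0) (cell ε i) := integrableOn_const hfin
    have h2 : ∫ x in cell ε i, fin x ≤ ∫ x in cell ε i, (max (fin x - M0) 0 + M0) := by
      refine setIntegral_mono (hf.mono_set hsub) ((hi0.mono_set hsub).add hc) fun x => ?_
      have := le_max_left (fin x - M0) 0
      simp only; linarith
    rw [integral_add (hi0.mono_set hsub) hc, setIntegral_const, measureReal_def, rbk_cell_vol, ENNReal.toReal_ofReal hε.le, smul_eq_mul] at h2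
    have h3 : 0 ≤ ∫ x in cell ε i, max (fin x - M0) 0 := integral_nonneg fun x => le_max_right _ _
    have h4 : ε⁻¹ * ∫ x in cell ε i, fin x ≤ ε⁻¹ * (∫ x in cell ε i, max (fin x - M0) 0) + M0 := by
      calc _ ≤ ε⁻¹ * ((∫ x in cell ε i, max (fin x - M0) 0) + ε * M0) := by gcongr
        _ = _ := by field_simp
    have h5 : 0 ≤ ε⁻¹ * (∫ x in cell ε i, max (fin x - M0) 0) := by positivity
    split_ifs
    · exact max_le (by linarith) (by linarith)
    · exact max_le (by linarith) (by linarith)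
  have h2 := sum_le_sum h1
  rw [sum_add_distrib, ← mul_sum] at h2
  have h3 := rbk_cellsum _ hi0 (fun x _ => le_max_right _ _) ε hε (Icc 1 I) (fun i hi => (mem_Icc.1 hi).1)
  have h4 := rbk_card ε s M0 hε hs hM I
  calc _ ≤ ε * (ε⁻¹ * (∑ i ∈ Icc 1 I, ∫ x in cell ε i, max (fin x - M0) 0) + s / ε * M0) := by gcongr; linarith
    _ = (∑ i ∈ Icc 1 I, ∫ x in cell ε i, max (fin x - M0) 0) + M0 * s := by field_simp
    _ ≤ _ := by linarith

open Finset in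
lemma rbk_mom (fin : ℝ → ℝ) (hfin_nonneg : ∀ x : ℝ, 0 < x → 0 ≤ fin x)
    (hfin_int : IntegrableOn (fun x => (1 + x) * fin x) (Set.Ioi 0)) (ε : ℝ) (hε : 0 < ε) :
    ε * ∑' i : ℕ, (ε⁻¹ * ∫ x in cell ε (i+1), fin x) ≤ 2 * ∫ x in Set.Ioi 0, (1 + x) * fin x ∧
    ε * (ε * ∑' i : ℕ, ((i:ℝ)+1) * (ε⁻¹ * ∫ x in cell ε (i+1), fin x)) ≤ 2 * ∫ x in Set.Ioi 0, (1 + x) * fin x := by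
  have hf := rbk_fin_int fin hfin_int
  have hnn : ∀ i : ℕ, 0 ≤ ∫ x in cell ε (i+1), fin x := fun i =>
    setIntegral_nonneg (rbk_cell_meas _ _) fun x hx => hfin_nonneg x (rbk_cell_sub ε hε (i+1) (by omega) hx)
  have hS : ∀ n, ∑ i ∈ range n, ∫ x in cell ε (i+1), (1 + x) * fin x ≤ ∫ x in Set.Ioi 0, (1 + x) * fin x := by
    intro n
    have := rbk_cellsum _ hfin_int (fun x hx => mul_nonneg (by linarith) (hfin_nonneg x hx)) ε hε (Icc 1 n) (fun i hi => (mem_Icc.1 hi).1)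
    refine le_trans (le_of_eq ?_) this
    rw [range_eq_Ico, sum_Ico_add' (fun i => ∫ x in cell ε i, (1 + x) * fin x)]
    congr 1
  have hsub := fun i : ℕ => rbk_cell_sub ε hε (i+1) (by omega)
  have hI := fun i : ℕ => hfin_int.mono_set (hsub i)
  have hIf := fun i : ℕ => hf.mono_set (hsub i)
  constructor
  · rw [← tsum_mul_left]
    refine Real.tsum_le_of_sum_range_le (fun i => ?_) (fun n => ?_)
    · have := hnn i; positivity
    · have hS' := hS n
      have : ∑ i ∈ range n, ε * (ε⁻¹ * ∫ x in cell ε (i+1), fin x) ≤ ∑ i ∈ range n, ∫ x in cell ε (i+1), (1 + x) * fin x := by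
        refine sum_le_sum fun i _ => ?_
        rw [mul_inv_cancel_left₀ hε.ne']
        refine setIntegral_mono_on (hIf i) (hI i) (rbk_cell_meas _ _) fun x hx => ?_
        have h1 : 0 < x := hsub i hx
        nlinarith [hfin_nonneg x h1]
      have h0 : 0 ≤ ∫ x in Set.Ioi 0, (1 + x) * fin x := setIntegral_nonneg measurableSet_Ioi fun x (hx : 0 < x) => mul_nonneg (by linarith) (hfin_nonneg x hx)
      linarith
  · rw [← tsum_mul_left, ← tsum_mul_left]
    refine Real.tsum_le_of_sum_range_le (fun i => ?_) (fun n => ?_)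
    · have := hnn i; positivity
    · have hS' := hS n
      have : ∑ i ∈ range n, ε * (ε * (((i:ℝ)+1) * (ε⁻¹ * ∫ x in cell ε (i+1), fin x))) ≤ ∑ i ∈ range n, 2 * ∫ x in cell ε (i+1), (1 + x) * fin x := by
        refine sum_le_sum fun i _ => ?_
        have e : ε * (ε * (((i:ℝ)+1) * (ε⁻¹ * ∫ x in cell ε (i+1), fin x))) = ∫ x in cell ε (i+1), (ε * ((i:ℝ)+1)) * fin x := by
          rw [integral_const_mul]; field_simp
        rw [e, ← integral_const_mul]
        refine setIntegral_mono_on ((hIf i).const_mul _) ((hI i).const_mul _) (rbk_cell_meas _ _) fun x hx => ?_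
        have h1 : 0 < x := hsub i hx
        have h2 := hx.1
        push_cast at h2
        have h4 : (0:ℝ) ≤ i * ε := by positivity
        have h3 : ε * ((i:ℝ)+1) ≤ 2 * (1 + x) := by nlinarith
        calc _ ≤ (2 * (1 + x)) * fin x := mul_le_mul_of_nonneg_right h3 (hfin_nonneg x h1)
          _ = _ := by ring
      refine this.trans ?_
      rw [← mul_sum]
      linarith

open Finset in
lemma rbk_int (ε B M L η : ℝ) (hε : 0 < ε) (hM : 0 ≤ M) (hL : 0 < L) (hη : 0 ≤ η) (I : ℕ) (F : ℕ → ℝ) (hF : ∀ i, 1 ≤ i → 0 ≤ F i)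
    (hI : ∀ i : ℕ, I < i → L ≤ ε * i) (hs2 : Summable (fun j : ℕ => ((j:ℝ)+1) * F (j+1)))
    (hB2 : ε * (ε * ∑' j : ℕ, ((j:ℝ)+1) * F (j+1)) ≤ B) (E : Set ℝ) 
    (hEv : volume E < ENNReal.ofReal η) :
    ∫ x in E, stepFn ε F x ≤ M * η + ε * ∑ i ∈ Icc 1 I, max (F i - M) 0 + B / L := by
  set u : ℕ → ℝ := fun i => if i < I then max (F (i+1) - M) 0 else 0 with hu
  set w : ℕ → ℝ := fun i => u i + ε / L * (((i:ℝ)+1) * F (i+1)) with hw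
  have hu0 : ∀ i, 0 ≤ u i := fun i => by simp only [hu]; split_ifs <;> simp
  have hw0 : ∀ i, 0 ≤ w i := fun i => by
    have := hF (i+1) (by omega)
    have := hu0 i
    simp only [hw]; positivity
  have hFw : ∀ i, F (i+1) ≤ M + w i := by
    intro i
    have h1 := hF (i+1) (by omega)
    simp only [hw, hu]
    split_ifs with h
    · have := le_max_left (F (i+1) - M) 0
      have : 0 ≤ ε / L * (((i:ℝ)+1) * F (i+1)) := by positivity
      linarith
    · have h2 := hI (i+1) (by omega)
      push_cast at h2
      have h3 : 1 ≤ ε * ((i:ℝ)+1) / L := by rwa [le_div_iff₀ hL, one_mul]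
      have h4 : ε / L * (((i:ℝ)+1) * F (i+1)) = ε * ((i:ℝ)+1) / L * F (i+1) := by ring
      rw [h4]
      nlinarith
  have husum : HasSum u (∑ i ∈ Icc 1 I, max (F i - M) 0) := by
    have : ∑ i ∈ Icc 1 I, max (F i - M) 0 = ∑ i ∈ range I, u i := by
      have e : ∑ i ∈ Icc 1 I, max (F i - M) 0 = ∑ j ∈ range I, max (F (j+1) - M) 0 := by
        rw [range_eq_Ico, sum_Ico_add' (fun i => max (F i - M) 0)]
        congr 1
      rw [e]
      refine sum_congr rfl fun i hi => ?_
      simp only [hu]; rw [if_pos (mem_range.1 hi)]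
    rw [this]
    refine hasSum_sum_of_ne_finset_zero fun i hi => ?_
    simp only [hu]; rw [if_neg (by simpa using hi)]
  have hwS : HasSum w (∑ i ∈ Icc 1 I, max (F i - M) 0 + ε / L * ∑' j : ℕ, ((j:ℝ)+1) * F (j+1)) :=
    husum.add (hs2.hasSum.mul_left _)
  have hpt : ∀ x, ENNReal.ofReal ‖stepFn ε F x‖ ≤ ENNReal.ofReal M + ∑' i, (cell ε (i+1)).indicator (fun _ => ENNReal.ofReal (w i)) x := by
    intro x
    by_cases hx : ∃ i : ℕ, x ∈ cell ε (i+1)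
    · obtain ⟨i, hi⟩ := hx
      have e : stepFn ε F x = F (i+1) := by
        rw [stepFn, tsum_eq_single i]
        · simp [hi]
        · intro j hj
          rw [Set.indicator_of_notMem, mul_zero]
          intro h
          exact hj (by have := rbk_cell_uniq ε hε _ _ x h hi; omega)
      rw [e, Real.norm_of_nonneg (hF _ (by omega))]
      calc _ ≤ ENNReal.ofReal (M + w i) := ENNReal.ofReal_le_ofReal (hFw i)
        _ = ENNReal.ofReal M + ENNReal.ofReal (w i) := ENNReal.ofReal_add hM (hw0 i)
        _ ≤ _ := by
          gcongr
          refine le_trans (le_of_eq ?_) (ENNReal.le_tsum i)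
          rw [Set.indicator_of_mem hi]
    · push Not at hx
      have e : stepFn ε F x = 0 := by
        rw [stepFn]
        simp [hx]
      rw [e]; simp
  have hlin : ∫⁻ x in E, ENNReal.ofReal ‖stepFn ε F x‖ ≤ ENNReal.ofReal (M * η + ε * ∑' i, w i) := by
    calc _ ≤ ∫⁻ x in E, (ENNReal.ofReal M + ∑' i, (cell ε (i+1)).indicator (fun _ => ENNReal.ofReal (w i)) x) := lintegral_mono hpt
      _ = ENNReal.ofReal M * volume E + ∑' i, ∫⁻ x in E, (cell ε (i+1)).indicator (fun _ => ENNReal.ofReal (w i)) x := by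
        rw [lintegral_add_left measurable_const, setLIntegral_const, lintegral_tsum]
        intro i
        exact (measurable_const.indicator (rbk_cell_meas _ _)).aemeasurable
      _ ≤ ENNReal.ofReal M * ENNReal.ofReal η + ∑' i, ENNReal.ofReal (w i * ε) := by
        gcongr with i
        refine (setLIntegral_le_lintegral _ _).trans ?_
        rw [lintegral_indicator_const (rbk_cell_meas _ _), rbk_cell_vol, ENNReal.ofReal_mul (hw0 i)]
      _ = _ := by
        rw [← ENNReal.ofReal_tsum_of_nonneg (fun i => mul_nonneg (hw0 i) hε.le) (hwS.summable.mul_right ε), tsum_mul_right,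
          ← ENNReal.ofReal_mul hM, ← ENNReal.ofReal_add (by positivity) (mul_nonneg (tsum_nonneg hw0) hε.le), mul_comm ε]
  calc _ ≤ ‖∫ x in E, stepFn ε F x‖ := Real.le_norm_self _
    _ ≤ ENNReal.toReal (∫⁻ x in E, ENNReal.ofReal ‖stepFn ε F x‖) := norm_integral_le_lintegral_norm _
    _ ≤ M * η + ε * ∑' i, w i := ENNReal.toReal_le_of_le_ofReal (add_nonneg (by positivity) (mul_nonneg hε.le (tsum_nonneg hw0))) hlin
    _ = M * η + ε * ∑ i ∈ Icc 1 I, max (F i - M) 0 + ε * (ε * ∑' j : ℕ, ((j:ℝ)+1) * F (j+1)) / L := by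
      rw [hwS.tsum_eq]; ring
    _ ≤ _ := by gcongr

/-- uniform integrability of the family `{f_ε(·,t) : ε ∈ (0,1), t ∈ [0,T]}`
of step functions associated with solutions of the discrete RBK system. -/
theorem stmt9
    (K : ℝ → ℝ → ℝ) (r : ℝ → ℝ) (α : ℝ → ℝ → ℝ) (A : ℝ) (hA : 0 < A)
    (hK_cont : ContinuousOn (fun p : ℝ × ℝ => K p.1 p.2) (Set.Ioi 0 ×ˢ Set.Ioi 0))
    (hK_symm : ∀ x y : ℝ, 0 < x → 0 < y → K x y = K y x)
    (hK_nonneg : ∀ x y : ℝ, 0 < x → 0 < y → 0 ≤ K x y)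
    (hr_cont : ContinuousOn r (Set.Ioi 0))
    (hr_nonneg : ∀ x : ℝ, 0 < x → 0 ≤ r x)
    (hα_cont : ContinuousOn (fun p : ℝ × ℝ => α p.1 p.2) (Set.Ioi 0 ×ˢ Set.Ioi 0))
    (hα_nonneg : ∀ x y : ℝ, 0 < x → 0 < y → 0 ≤ α x y)
    (hα_symm : ∀ x y : ℝ, 0 < x → 0 < y → α x y = α y x)
    (hK_form : ∀ x y : ℝ, 0 < x → 0 < y → K x y = r x * r y + α x y)
    (hα_bound : ∀ x y : ℝ, 1 ≤ x → 1 ≤ y → α x y ≤ A * r x * r y)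
    (ω : ℝ → ℝ → ℝ)
    (hω_bound : ∀ R : ℝ, 1 ≤ R → ∀ y : ℝ, 0 < y → ∀ x : ℝ, 0 < x → x ≤ R → K x y / y ≤ ω R y)
    (hω_lim : ∀ R : ℝ, 1 ≤ R → Filter.Tendsto (ω R) Filter.atTop (nhds 0))
    (Ω : ℝ → ℝ)
    (hΩ_bound : ∀ R : ℝ, 1 ≤ R → ∀ x : ℝ, R ≤ x → r x / x ≤ Ω R)
    (hΩ_lim : Filter.Tendsto Ω Filter.atTop (nhds 0))
    (fin : ℝ → ℝ)
    (hfin_nonneg : ∀ x : ℝ, 0 < x → 0 ≤ fin x)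
    (hfin_int : IntegrableOn (fun x => (1 + x) * fin x) (Set.Ioi 0))
    (f : ℝ → ℕ → ℝ → ℝ)
    (hsol : ∀ ε : ℝ, 0 < ε → ε < 1 →
      IsDRBKSol (fun i j => ε * K (ε * i) (ε * j))
        (fun i => ε⁻¹ * ∫ x in cell ε i, fin x) (f ε)) :
    ∀ T : ℝ, 0 < T → ∀ δ : ℝ, 0 < δ → ∃ η : ℝ, 0 < η ∧
      ∀ E : Set ℝ, MeasurableSet E → E ⊆ Set.Ioi 0 → volume E < ENNReal.ofReal η →
        ∀ ε : ℝ, 0 < ε → ε < 1 → ∀ t : ℝ, 0 ≤ t → t ≤ T →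
          (∫ x in E, stepFn ε (fun i => f ε i t) x) < δ := by
  intro T hT δ hδ
  set d := δ / 8 with hd
  have hd0 : 0 < d := by positivity
  have hf := rbk_fin_int fin hfin_int
  have hN0 : 0 ≤ ∫ x in Set.Ioi 0, (1 + x) * fin x := setIntegral_nonneg measurableSet_Ioi
    fun x (hx : 0 < x) => mul_nonneg (by linarith) (hfin_nonneg x hx)
  set B := 2 * (∫ x in Set.Ioi 0, (1 + x) * fin x) + 1 with hBdef
  have hB : 0 < B := by linarith
  set ρ := d / (4 * T * B^2) with hρdef
  have hρ : 0 < ρ := by positivity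
  have hρ2 : T * (2 * ρ * B^2) = d / 2 := by rw [hρdef]; field_simp; ring
  obtain ⟨L0, hL01, hL0⟩ := rbk_kernel_tail K r α A hA hK_symm hr_nonneg hK_form hα_bound ω hω_bound hω_lim Ω
    hΩ_bound hΩ_lim ρ hρ
  set L := max L0 (B / d) with hLdef
  have hL1 : 1 ≤ L := hL01.trans (le_max_left _ _)
  have hLpos : 0 < L := by linarith
  have hBL : B / L ≤ d := by
    rw [div_le_iff₀ hLpos]
    have : B / d ≤ L := le_max_right _ _
    rw [div_le_iff₀ hd0] at this
    linarith
  obtain ⟨M0, hM0, hM0d⟩ := rbk_trunc fin hf d hd0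
  obtain ⟨n, hn⟩ := exists_nat_ge (max 1 (B / d))
  have hn1 : (1:ℝ) ≤ n := (le_max_left _ _).trans hn
  have hnB : B ≤ n * d := by
    have := (le_max_right _ _).trans hn
    rwa [div_le_iff₀ hd0] at this
  -- local bounds of the kernel
  have hCex : ∀ s : ℝ, ∃ C : ℝ, 0 ≤ C ∧ (0 < s → ∀ x y, s ≤ x → x ≤ L → s ≤ y → y ≤ L → K x y ≤ C) := by
    intro s
    by_cases hs : 0 < s
    · have hc : IsCompact (Set.Icc s L ×ˢ Set.Icc s L) := isCompact_Icc.prod isCompact_Icc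
      obtain ⟨C, hC⟩ := hc.bddAbove_image (hK_cont.mono (Set.prod_mono (fun x hx => lt_of_lt_of_le hs hx.1)
        (fun x hx => lt_of_lt_of_le hs hx.1)))
      refine ⟨max C 0, le_max_right _ _, fun _ x y h1 h2 h3 h4 => ?_⟩
      exact (hC ⟨(x, y), ⟨⟨h1, h2⟩, ⟨h3, h4⟩⟩, rfl⟩).trans (le_max_left _ _)
    · exact ⟨0, le_rfl, fun h => absurd h hs⟩
  choose Cf hCf0 hCf using hCex
  set q : ℝ → ℝ := fun x => 1 + M0 + T * Cf x * (M0 * Real.exp (Cf x * B * T)) * B with hq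
  have hq0 : ∀ x, 0 < q x := fun x => by have := hCf0 x; simp only [hq]; positivity
  set nxt : ℝ → ℝ := fun x => min x (d / q x) with hnxt
  set s : ℕ → ℝ := fun k => nxt^[k] 1 with hs
  have hsS : ∀ k, s (k+1) = min (s k) (d / q (s k)) := fun k => by
    simp only [hs, Function.iterate_succ', Function.comp_apply, hnxt]
  have hspos : ∀ k, 0 < s k := by
    intro k
    induction k with
    | zero => simp [hs]
    | succ k ih => rw [hsS]; exact lt_min ih (div_pos hd0 (hq0 _))
  have hsa : ∀ k, s (k+1) ≤ s k := fun k => by rw [hsS]; exact min_le_left _ _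
  have hsq : ∀ k, s (k+1) * q (s k) ≤ d := fun k => by
    have : s (k+1) ≤ d / q (s k) := by rw [hsS]; exact min_le_right _ _
    rwa [le_div_iff₀ (hq0 _)] at this
  set C : ℕ → ℝ := fun k => Cf (s k) with hC
  have hC0 : ∀ k, 0 ≤ C k := fun k => hCf0 _
  have hsM : ∀ k, M0 * s (k+1) ≤ d := fun k => by
    refine le_trans ?_ (hsq k)
    rw [mul_comm]
    refine mul_le_mul_of_nonneg_left ?_ (hspos _).le
    have := hCf0 (s k)
    have : 0 ≤ T * Cf (s k) * (M0 * Real.exp (Cf (s k) * B * T)) * B := by positivity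
    simp only [hq]; linarith
  have hsC : ∀ k, T * (s (k+1) * C k * (M0 * Real.exp (C k * B * T)) * B) ≤ d := fun k => by
    refine le_trans ?_ (hsq k)
    have : T * (s (k+1) * C k * (M0 * Real.exp (C k * B * T)) * B) = s (k+1) * (T * C k * (M0 * Real.exp (C k * B * T)) * B) := by ring
    rw [this]
    refine mul_le_mul_of_nonneg_left ?_ (hspos _).le
    simp only [hq, hC]; linarith
  set Q := 1 + ∑ k ∈ Finset.range n, M0 * Real.exp (C k * B * T) with hQ
  have hQ0 : 0 < Q := by
    have : 0 ≤ ∑ k ∈ Finset.range n, M0 * Real.exp (C k * B * T) := Finset.sum_nonneg fun k _ => by positivity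
    linarith
  refine ⟨d / Q, by positivity, ?_⟩
  intro E hE hE0 hEv ε hε hε1 t ht htT
  obtain ⟨h1, h2, h3, h4, h5, h6, h7, h8⟩ := hsol ε hε hε1
  obtain ⟨hm1, hm2⟩ := rbk_mom fin hfin_nonneg hfin_int ε hε
  have hs1 : ∀ t, 0 ≤ t → Summable (fun j : ℕ => f ε (j+1) t) := by
    intro t ht
    refine Summable.of_nonneg_of_le (fun j => h1 _ (by omega) t ht) (fun j => ?_) (h5 t ht)
    have := h1 (j+1) (by omega) t ht
    have hj : (0:ℝ) ≤ j := j.cast_nonneg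
    nlinarith
  have hB1 : ∀ t, 0 ≤ t → ε * ∑' j : ℕ, f ε (j+1) t ≤ B := fun t ht => by
    have := mul_le_mul_of_nonneg_left (h7 t ht) hε.le
    linarith
  have hB2 : ∀ t, 0 ≤ t → ε * (ε * ∑' j : ℕ, ((j:ℝ)+1) * f ε (j+1) t) ≤ B := fun t ht => by
    have := mul_le_mul_of_nonneg_left (mul_le_mul_of_nonneg_left (h6 t ht) hε.le) hε.le
    linarith
  set I := ⌊L / ε⌋₊ with hI
  have hI1 : ∀ i : ℕ, I < i → L ≤ ε * i := fun i hi => by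
    have := (Nat.floor_lt (by positivity)).1 hi
    rw [div_lt_iff₀ hε] at this
    linarith
  have hI2 : ∀ i : ℕ, i ≤ I → ε * i ≤ L := fun i hi => by
    have := (Nat.le_floor_iff (by positivity)).1 hi
    rw [le_div_iff₀ hε] at this
    linarith
  have hpos : ∀ i : ℕ, 1 ≤ i → 0 < ε * i := fun i hi => mul_pos hε (by exact_mod_cast hi)
  have hdyn := rbk_dyn (fun i j => ε * K (ε * i) (ε * j)) (f ε) ε ρ B M0 T I n hε hρ.le hB.le hM0 s C
    (fun k => (hspos k).le) hsa hC0 h1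
    (fun i j hi hj => mul_nonneg hε.le (hK_nonneg _ _ (hpos i hi) (hpos j hj)))
    (fun i j hi hj => by rw [hK_symm _ _ (hpos i hi) (hpos j hj)])
    (fun m j hm hj hjm => by
      refine mul_le_mul_of_nonneg_left ?_ hε.le
      refine hL0 _ ((le_max_left _ _).trans (hI1 m hm)) _ (hpos j hj) ?_
      gcongr)
    (fun k m j hj hjm hmI hsk => by
      refine mul_le_mul_of_nonneg_left ?_ hε.le
      have hjm' : ε * (j:ℝ) ≤ ε * m := by gcongr
      exact hCf (s k) (hspos k) _ _ (hsk.trans hjm') (hI2 m hmI) hsk (hI2 j (by omega)))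
    hs1 h5 hB1 hB2 h3 t ht htT
  have hS0 : ε * ∑ i ∈ Finset.Icc 1 I, f ε i 0 ≤ B := by
    refine le_trans (mul_le_mul_of_nonneg_left ?_ hε.le) (hB1 0 le_rfl)
    have e : ∑ i ∈ Finset.Icc 1 I, f ε i 0 = ∑ i ∈ Finset.range I, f ε (i+1) 0 := by
      rw [Finset.range_eq_Ico, Finset.sum_Ico_add' (fun i => f ε i 0)]
      congr 1
    rw [e]
    exact (hs1 0 le_rfl).sum_le_tsum _ fun i _ => h1 _ (by omega) 0 le_rfl
  have hH0 : ∀ k ∈ Finset.range n, ε * ∑ i ∈ Finset.Icc 1 I, max (f ε i 0 - if s (k+1) ≤ ε * i then M0 else 0) 0 ≤ 2 * d := by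
    intro k _
    have := rbk_init fin hf M0 ε (s (k+1)) hM0 hε (hspos _).le I
    have e : ∑ i ∈ Finset.Icc 1 I, max (f ε i 0 - if s (k+1) ≤ ε * i then M0 else 0) 0
        = ∑ i ∈ Finset.Icc 1 I, max ((ε⁻¹ * ∫ x in cell ε i, fin x) - if s (k+1) ≤ ε * i then M0 else 0) 0 := by
      refine Finset.sum_congr rfl fun i hi => ?_
      rw [h2 i (Finset.mem_Icc.1 hi).1]
    rw [e]
    linarith [hsM k]
  have hH0' := Finset.sum_le_sum hH0
  have hsC' : ∑ k ∈ Finset.range n, T * (s (k+1) * C k * (M0 * Real.exp (C k * B * T)) * B) ≤ ∑ k ∈ Finset.range n, d :=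
    Finset.sum_le_sum fun k _ => hsC k
  simp only [Finset.sum_const, Finset.card_range, nsmul_eq_mul] at hH0' hsC'
  rw [← Finset.mul_sum] at hH0' hsC'
  have htot : ∑ k ∈ Finset.range n, ε * ∑ i ∈ Finset.Icc 1 I, max (f ε i t - if s (k+1) ≤ ε * i then M0 * Real.exp (C k * B * t) else 0) 0
      ≤ ∑ k ∈ Finset.range n, 5 * d := by
    rw [← Finset.mul_sum]
    refine (mul_le_mul_of_nonneg_left hdyn hε.le).trans ?_
    have e1 : ε * (t * ((n+1) * (2 * ρ * B^2 / ε) + ∑ k ∈ Finset.range n, s (k+1) * C k * (M0 * Real.exp (C k * B * T)) * B / ε))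
        = t * ((n+1) * (2 * ρ * B^2) + ∑ k ∈ Finset.range n, s (k+1) * C k * (M0 * Real.exp (C k * B * T)) * B) := by
      rw [← Finset.sum_div]
      generalize (∑ k ∈ Finset.range n, s (k+1) * C k * (M0 * Real.exp (C k * B * T)) * B) = Z
      field_simp
    have e2 : t * ((n+1) * (2 * ρ * B^2) + ∑ k ∈ Finset.range n, s (k+1) * C k * (M0 * Real.exp (C k * B * T)) * B)
        ≤ T * ((n+1) * (2 * ρ * B^2) + ∑ k ∈ Finset.range n, s (k+1) * C k * (M0 * Real.exp (C k * B * T)) * B) := by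
      refine mul_le_mul_of_nonneg_right htT (add_nonneg (by positivity) (Finset.sum_nonneg fun k _ => ?_))
      have := hspos (k+1)
      have := hC0 k
      positivity
    have e3 : T * ((n+1) * (2 * ρ * B^2)) = (n+1) * (d/2) := by rw [← hρ2]; ring
    have e4 : ((n:ℝ)+1) * (d/2) ≤ n * d := by nlinarith
    rw [mul_add, mul_add, e1]
    simp only [Finset.sum_const, Finset.card_range, nsmul_eq_mul]
    linarith
  obtain ⟨k, hk, hkle⟩ := Finset.exists_le_of_sum_le (by
    have : 0 < n := by exact_mod_cast (lt_of_lt_of_le one_pos hn1)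
    exact Finset.nonempty_range_iff.2 this.ne') htot
  have hMk : M0 * Real.exp (C k * B * t) * (d / Q) ≤ d := by
    have h9 : M0 * Real.exp (C k * B * t) ≤ M0 * Real.exp (C k * B * T) := by
      have := hC0 k
      gcongr
    have h10 : M0 * Real.exp (C k * B * T) ≤ ∑ k ∈ Finset.range n, M0 * Real.exp (C k * B * T) :=
      Finset.single_le_sum (f := fun k => M0 * Real.exp (C k * B * T)) (fun k _ => by positivity) hk
    have h11 : M0 * Real.exp (C k * B * t) ≤ Q := by linarith
    calc _ ≤ Q * (d / Q) := mul_le_mul_of_nonneg_right h11 (by positivity)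
      _ = d := by field_simp
  have hfinal := rbk_int ε B (M0 * Real.exp (C k * B * t)) L (d / Q) hε (by positivity) hLpos (by positivity) I
    (fun i => f ε i t) (fun i hi => h1 i hi t ht) hI1 (h5 t ht) (hB2 t ht) E hEv
  have hcmp : ε * ∑ i ∈ Finset.Icc 1 I, max (f ε i t - M0 * Real.exp (C k * B * t)) 0 ≤ 5 * d := by
    refine le_trans (mul_le_mul_of_nonneg_left (Finset.sum_le_sum fun i _ => ?_) hε.le) hkle
    refine max_le_max ?_ le_rfl
    have : 0 ≤ M0 * Real.exp (C k * B * t) := by positivity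
    split_ifs <;> linarith
  have : (∫ x in E, stepFn ε (fun i => f ε i t) x) ≤ 7 * d := by linarith
  linarith
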